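/- (Porous medium, Euclidean case.) Let N ≥ 1 and m ≥ 1, and take p = 2 and f ≡ m in the setting. Let a : ℝ^N → ℝ be locally Lipschitz, bounded, with a > 0 a.e., and V ≡ 1. If m < q ≤ 2/N + m, then every global nonnegative weak solution of ∂_t u ≥ (1/a) div(a m u^{m−1} ∇u) + u^q (which for a ≡ 1 is the weak form of ∂_t u ≥ Δ(u^m) + u^q) on S = ℝ^N × (0,∞) is zero a.e. -/

import Mathlib

open MeasureTheory Real Set Metric
open scoped ENNReal RealInnerProductSpace

noncomputable section

/-- Euclidean space `ℝ^N`. -/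
abbrev Euc (N : ℕ) : Type := EuclideanSpace ℝ (Fin N)

/-- The parabolic slab `S = ℝ^N × (0,∞)`. -/
def Sset (N : ℕ) : Set (Euc N × ℝ) := {z : Euc N × ℝ | 0 < z.2}

/-- The weighted measure `μ_a = a(x) dx` on `ℝ^N`. -/
def muA {N : ℕ} (a : Euc N → ℝ) : Measure (Euc N) :=
  (volume : Measure (Euc N)).withDensity (fun x => ENNReal.ofReal (a x))

/-- The measure `dμ_a dt` on `ℝ^N × (0,∞)`. -/
def muS {N : ℕ} (a : Euc N → ℝ) : Measure (Euc N × ℝ) :=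
  (muA a).prod ((volume : Measure ℝ).restrict (Set.Ioi (0 : ℝ)))

/-- The continuous linear functional `(w, τ) ↦ ⟪v, w⟫ + c·τ` on `ℝ^N × ℝ`,
encoding a space-time differential with spatial gradient `v` and time derivative `c`. -/
def pairCLM {N : ℕ} (v : Euc N) (c : ℝ) : (Euc N × ℝ) →L[ℝ] ℝ :=
  ((innerSL ℝ v).comp (ContinuousLinearMap.fst ℝ (Euc N) ℝ)) +
    c • (ContinuousLinearMap.snd ℝ (Euc N) ℝ)

/-- `u` is a global nonnegative weak solution of
`∂ₜ u ≥ (1/a) div(a u^{m-1} |∇u|^{p-2} f(|∇u|) ∇u) + V u^q` on `S = ℝ^N × (0,∞)`,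
where `gu`, `ut` are a.e. representatives of the spatial gradient and the time
derivative of `u`. -/
structure IsWeakSol (N : ℕ) (p m q : ℝ) (V : Euc N × ℝ → ℝ) (f : ℝ → ℝ)
    (a : Euc N → ℝ) (u : Euc N × ℝ → ℝ) (gu : Euc N × ℝ → Euc N)
    (ut : Euc N × ℝ → ℝ) : Prop where
  nonneg : ∀ z ∈ Sset N, 0 ≤ u z
  locLip : LocallyLipschitzOn (Sset N) u
  deriv_ae : ∀ᵐ z ∂ ((volume : Measure (Euc N × ℝ)).restrict (Sset N)),
      DifferentiableAt ℝ u z → HasFDerivAt u (pairCLM (gu z) (ut z)) z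
  int_uqV : LocallyIntegrableOn (fun z => u z ^ q * V z) (Sset N) (muS a)
  int_upm : LocallyIntegrableOn (fun z => u z ^ (p + m - 1)) (Sset N) (muS a)
  int_gu : LocallyIntegrableOn (fun z => ‖gu z‖ ^ p * u z ^ (m - 1)) (Sset N) (muS a)
  int_ut : LocallyIntegrableOn (fun z => u z * ut z) (Sset N) (muS a)
  weak_ineq : ∀ (ψ : Euc N × ℝ → ℝ) (gψ : Euc N × ℝ → Euc N) (tψ : Euc N × ℝ → ℝ),
      (∀ z, 0 ≤ ψ z) → LocallyLipschitz ψ → HasCompactSupport ψ →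
      tsupport ψ ⊆ Sset N →
      (∀ᵐ z ∂ (volume : Measure (Euc N × ℝ)),
        DifferentiableAt ℝ ψ z → HasFDerivAt ψ (pairCLM (gψ z) (tψ z)) z) →
      ∫ z, ψ z * u z ^ q * V z ∂ muS a ≤
        (∫ z, ⟪gψ z, gu z⟫ * u z ^ (m - 1) * ‖gu z‖ ^ (p - 2) * f ‖gu z‖ ∂ muS a)
          - ∫ z, tψ z * u z ∂ muS a

/-- The region `E_R = {(x,t) ∈ S : |x|^θ2 + t^θ1 ≤ R^θ2}`. -/
def ESet (N : ℕ) (θ1 θ2 R : ℝ) : Set (Euc N × ℝ) :=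
  {z ∈ Sset N | ‖z.1‖ ^ θ2 + z.2 ^ θ1 ≤ R ^ θ2}

/-- The time cutoff `χ_β`. -/
def chi (β t : ℝ) : ℝ := min 1 (max 0 (t / β - 1))

lemma LocallyLipschitz.exists_lipschitzWith_of_hasCompactSupport {E : Type*}
    [NormedAddCommGroup E] [ProperSpace E] {f : E → ℝ} (hf : LocallyLipschitz f)
    (hc : HasCompactSupport f) : ∃ C, LipschitzWith C f := by
  obtain ⟨r, hr⟩ := hc.isCompact.isBounded.subset_closedBall 0
  obtain ⟨K, hK⟩ := (hf.locallyLipschitzOn (s := closedBall 0 (r + 1))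
    ).exists_lipschitzOnWith_of_compact (isCompact_closedBall 0 (r + 1))
  obtain ⟨M, hM⟩ := hf.continuous.bounded_above_of_compact_support hc
  have hz : ∀ x : E, x ∉ closedBall 0 r → f x = 0 := fun x hx =>
    image_eq_zero_of_notMem_tsupport fun h => hx (hr h)
  have hM0 : 0 ≤ M := (norm_nonneg _).trans (hM 0)
  refine ⟨K + (2 * M).toNNReal, LipschitzWith.of_dist_le_mul fun x y => ?_⟩
  have hd := dist_nonneg (x := x) (y := y)
  rw [NNReal.coe_add, Real.coe_toNNReal _ (by positivity), add_mul]
  have hKd : 0 ≤ (K : ℝ) * dist x y := by positivity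
  have hMd : 0 ≤ 2 * M * dist x y := by positivity
  have hfar : 1 ≤ dist x y → dist (f x) (f y) ≤ K * dist x y + 2 * M * dist x y := fun h => by
    have h1 : dist (f x) (f y) ≤ M + M :=
      (dist_le_norm_add_norm _ _).trans (add_le_add (hM x) (hM y))
    nlinarith
  rcases le_or_gt 1 (dist x y) with h | h
  · exact hfar h
  have key : ∀ x y : E, dist x y < 1 → x ∈ closedBall (0 : E) r → y ∈ closedBall (0 : E) (r + 1) :=
    fun x y h hx => by
      rw [mem_closedBall] at hx ⊢
      linarith [dist_triangle y x 0, dist_comm x y]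
  have hsub : closedBall (0 : E) r ⊆ closedBall 0 (r + 1) := closedBall_subset_closedBall (by simp)
  by_cases hx : x ∈ closedBall (0 : E) r
  · linarith [hK.dist_le_mul x (hsub hx) y (key x y h hx)]
  by_cases hy : y ∈ closedBall (0 : E) r
  · linarith [hK.dist_le_mul x (key y x (by rwa [dist_comm]) hy) y (hsub hy)]
  rw [hz x hx, hz y hy, dist_self]
  positivity

lemma LocallyLipschitzOn.ae_differentiableAt {E : Type*} [NormedAddCommGroup E] [NormedSpace ℝ E]
    [FiniteDimensional ℝ E] [MeasurableSpace E] [BorelSpace E] (μ : Measure E)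
    [μ.IsAddHaarMeasure] {s : Set E} (hs : IsOpen s) {f : E → ℝ} (hf : LocallyLipschitzOn s f) :
    ∀ᵐ x ∂(μ.restrict s), DifferentiableAt ℝ f x := by
  rw [ae_restrict_iff' hs.measurableSet]
  have h : ∀ x ∈ s, ∃ t ∈ nhdsWithin x s, ∀ᵐ y ∂μ, y ∈ t → DifferentiableAt ℝ f y := by
    intro x hx
    obtain ⟨K, t, ht, hK⟩ := hf hx
    rw [hs.nhdsWithin_eq hx] at ht ⊢
    refine ⟨interior t, interior_mem_nhds.2 ht, ?_⟩
    filter_upwards [hK.ae_differentiableWithinAt_of_mem (μ := μ)] with y hy hyt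
    exact (hy (interior_subset hyt)).differentiableAt (mem_interior_iff_mem_nhds.1 hyt)
  choose! t ht hd using h
  obtain ⟨c, hcs, hc, hcov⟩ := TopologicalSpace.countable_cover_nhdsWithin ht
  have := (ae_ball_iff hc).2 fun x hx => hd x (hcs hx)
  filter_upwards [this] with y hy hys
  obtain ⟨x, hxc, hxy⟩ := mem_iUnion₂.1 (hcov hys)
  exact hy x hxc hxy

instance (N : ℕ) : (volume : Measure (Euc N × ℝ)).IsAddHaarMeasure :=
  inferInstanceAs ((volume : Measure (Euc N)).prod (volume : Measure ℝ)).IsAddHaarMeasure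

lemma isOpen_Sset (N : ℕ) : IsOpen (Sset N) := isOpen_lt continuous_const continuous_snd

/-- The time derivative of a compactly supported Lipschitz function integrates to zero
against a time-independent weight. -/
lemma integral_timeDeriv_mul_eq_zero {N : ℕ} {a : Euc N → ℝ} (ha : LocallyLipschitz a)
    {Θ : Euc N × ℝ → ℝ} (hΘ : LocallyLipschitz Θ) (hc : HasCompactSupport Θ)
    {gΘ : Euc N × ℝ → Euc N} {tΘ : Euc N × ℝ → ℝ}
    (hd : ∀ᵐ z, HasFDerivAt Θ (pairCLM (gΘ z) (tΘ z)) z) :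
    ∫ z, a z.1 * tΘ z = 0 := by
  obtain ⟨C, hC⟩ := hΘ.exists_lipschitzWith_of_hasCompactSupport hc
  obtain ⟨r, hr⟩ := (hc.isCompact.image continuous_fst).isBounded.subset_closedBall 0
  obtain ⟨K, hK⟩ := (ha.locallyLipschitzOn (s := closedBall 0 r)
    ).exists_lipschitzOnWith_of_compact (isCompact_closedBall 0 r)
  obtain ⟨b, hb, hab⟩ := hK.extend_real
  have hb' : LipschitzWith (K * 1) (fun z : Euc N × ℝ => b z.1) := hb.comp LipschitzWith.prod_fst
  have h := hb'.integral_lineDeriv_mul_eq (μ := volume) hC hc (0, 1)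
  have h0 : ∀ z : Euc N × ℝ, lineDeriv ℝ (fun z : Euc N × ℝ => b z.1) z (0, 1) = 0 := by
    intro z
    simp [lineDeriv]
  simp only [h0, zero_mul, integral_zero] at h
  rw [← neg_eq_zero, ← integral_neg, h]
  refine integral_congr_ae ?_
  filter_upwards [hd] with z hz
  rw [hz.hasLineDerivAt (-(0, 1)) |>.lineDeriv]
  by_cases hzs : z ∈ tsupport Θ
  · rw [← hab (hr (mem_image_of_mem _ hzs))]
    simp [pairCLM, mul_comm]
  · have : HasFDerivAt Θ (0 : Euc N × ℝ →L[ℝ] ℝ) z := by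
      rw [notMem_tsupport_iff_eventuallyEq] at hzs
      exact (hasFDerivAt_const (0 : ℝ) z).congr_of_eventuallyEq hzs
    have h2 := congrArg (fun L => L (0, 1)) (hz.unique this)
    have h3 : tΘ z = 0 := by simpa [pairCLM] using h2
    rw [hz.unique this, h3]
    simp

lemma muS_eq {N : ℕ} {a : Euc N → ℝ} (ha : Measurable a) :
    muS a = ((volume : Measure (Euc N × ℝ)).restrict (Sset N)).withDensity
      fun z => ENNReal.ofReal (a z.1) := by
  have hS : Sset N = univ ×ˢ Ioi (0 : ℝ) := by ext; simp [Sset]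
  rw [muS, muA, prod_withDensity_left ha.ennreal_ofReal, hS, Measure.volume_eq_prod,
    ← Measure.prod_restrict, Measure.restrict_univ]

lemma ae_fst_of_ae {N : ℕ} {P : Euc N → Prop} (h : ∀ᵐ x, P x) :
    ∀ᵐ z ∂((volume : Measure (Euc N × ℝ)).restrict (Sset N)), P z.1 :=
  ae_restrict_of_ae (Measure.quasiMeasurePreserving_fst.ae h)

lemma integral_muS {N : ℕ} {a : Euc N → ℝ} (ha : Measurable a) (hpos : ∀ᵐ x, 0 < a x)
    (F : Euc N × ℝ → ℝ) : ∫ z, F z ∂(muS a) = ∫ z in Sset N, a z.1 * F z := by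
  rw [muS_eq ha, integral_withDensity_eq_integral_toReal_smul (by fun_prop) (by simp)]
  refine integral_congr_ae ?_
  filter_upwards [ae_fst_of_ae hpos] with z hz
  simp [hz.le]

lemma ae_muS_iff {N : ℕ} {a : Euc N → ℝ} (ha : Measurable a) (hpos : ∀ᵐ x, 0 < a x)
    (P : Euc N × ℝ → Prop) :
    (∀ᵐ z ∂(muS a), P z) ↔ ∀ᵐ z ∂((volume : Measure (Euc N × ℝ)).restrict (Sset N)), P z := by
  rw [muS_eq ha, ae_withDensity_iff (by fun_prop)]
  refine Filter.eventually_congr ?_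
  filter_upwards [ae_fst_of_ae hpos] with z hz
  simp [hz]

lemma muS_le {N : ℕ} {a : Euc N → ℝ} (ha : Measurable a) {C : ℝ} (hC : ∀ x, |a x| ≤ C) :
    muS a ≤ ENNReal.ofReal C • (volume : Measure (Euc N × ℝ)).restrict (Sset N) := by
  rw [muS_eq ha, ← withDensity_const]
  exact withDensity_mono (ae_of_all _ fun z => ENNReal.ofReal_le_ofReal ((le_abs_self _).trans (hC _)))

lemma isFiniteMeasureOnCompacts_muS {N : ℕ} {a : Euc N → ℝ} (ha : Measurable a) {C : ℝ}
    (hC : ∀ x, |a x| ≤ C) : IsFiniteMeasureOnCompacts (muS a) := by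
  refine ⟨fun K hK => (muS_le ha hC K).trans_lt ?_⟩
  rw [Measure.smul_apply, smul_eq_mul]
  exact ENNReal.mul_lt_top ENNReal.ofReal_lt_top
    ((Measure.restrict_apply_le _ _).trans_lt hK.measure_lt_top)

lemma muS_cylinder_le {N : ℕ} {a : Euc N → ℝ} (ha : Measurable a) {C : ℝ}
    (hC : ∀ x, |a x| ≤ C) {r s : ℝ} (hr : 0 ≤ r) :
    muS a (closedBall 0 r ×ˢ Iic s) ≤
      ENNReal.ofReal (C * (r ^ N * (volume (ball (0 : Euc N) 1)).toReal * s)) := by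
  have hC0 : 0 ≤ C := (abs_nonneg _).trans (hC 0)
  refine (muS_le ha hC _).trans ?_
  have hS : Sset N = univ ×ˢ Ioi (0 : ℝ) := by ext; simp [Sset]
  rw [Measure.smul_apply, smul_eq_mul, Measure.restrict_apply
    (measurableSet_closedBall.prod measurableSet_Iic), hS, prod_inter_prod, inter_univ,
    Iic_inter_Ioi, Measure.volume_eq_prod, Measure.prod_prod,
    Measure.addHaar_closedBall _ _ hr, Real.volume_Ioc, finrank_euclideanSpace_fin, sub_zero,
    ENNReal.ofReal_mul hC0, ENNReal.ofReal_mul (by positivity), ENNReal.ofReal_mul (by positivity),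
    ENNReal.ofReal_toReal measure_ball_lt_top.ne]

lemma pairCLM_apply {N : ℕ} (v : Euc N) (c : ℝ) (w : Euc N × ℝ) :
    pairCLM v c w = ⟪v, w.1⟫ + c * w.2 := by
  simp [pairCLM]

lemma pairCLM_zero (N : ℕ) : pairCLM (0 : Euc N) 0 = 0 := by
  ext <;> simp [pairCLM]

lemma eq_zero_of_pairCLM_eq_zero {N : ℕ} {v : Euc N} {c : ℝ} (h : pairCLM v c = 0) :
    v = 0 ∧ c = 0 := by
  constructor
  · have := congrArg (fun L => L (v, 0)) h
    simpa [pairCLM_apply] using this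
  · have := congrArg (fun L => L (0, 1)) h
    simpa [pairCLM_apply] using this

lemma continuous_mul_of_tsupport_subset {E : Type*} [TopologicalSpace E] {s : Set E}
    (hs : IsOpen s) {f v : E → ℝ} (hf : Continuous f) (hfs : tsupport f ⊆ s)
    (hv : ContinuousOn v s) : Continuous fun z => f z * v z := by
  refine continuous_of_tsupport fun z hz => ?_
  exact hf.continuousAt.mul (hv.continuousAt (hs.mem_nhds (hfs (tsupport_mul_subset_left hz))))

lemma hasFDerivAt_mul_comp {N : ℕ} {φ u : Euc N × ℝ → ℝ} {g : ℝ → ℝ} {gφ gu : Euc N}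
    {tφ ut g' : ℝ} {z : Euc N × ℝ} (hφ : HasFDerivAt φ (pairCLM gφ tφ) z)
    (hu : HasFDerivAt u (pairCLM gu ut) z) (hg : HasDerivAt g g' (u z)) :
    HasFDerivAt (fun z => φ z * g (u z))
      (pairCLM (g (u z) • gφ + (φ z * g') • gu) (g (u z) * tφ + φ z * g' * ut)) z := by
  have h := hφ.mul (hg.comp_hasFDerivAt z hu)
  refine h.congr_fderiv (ContinuousLinearMap.ext fun w => ?_)
  simp only [add_apply, smul_apply, pairCLM_apply,
    smul_eq_mul, inner_add_left, real_inner_smul_left, Function.comp_apply]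
  ring

lemma hasFDerivAt_mul_comp_of_notMem_tsupport {N : ℕ} {φ u : Euc N × ℝ → ℝ} {g : ℝ → ℝ}
    {gφ gu : Euc N} {tφ ut c g' : ℝ} {z : Euc N × ℝ} (hφ : HasFDerivAt φ (pairCLM gφ tφ) z)
    (hz : z ∉ tsupport φ) :
    HasFDerivAt (fun z => φ z * g (u z))
      (pairCLM (c • gφ + (φ z * g') • gu) (c * tφ + φ z * g' * ut)) z := by
  have he := notMem_tsupport_iff_eventuallyEq.1 hz
  have h0 : pairCLM gφ tφ = 0 :=
    hφ.unique ((hasFDerivAt_const (0 : ℝ) z).congr_of_eventuallyEq he)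
  obtain ⟨h1, h2⟩ := eq_zero_of_pairCLM_eq_zero h0
  have h3 : φ z = 0 := he.self_of_nhds
  rw [h1, h2, h3]
  simp only [smul_zero, zero_mul, zero_smul, add_zero, mul_zero, pairCLM_zero]
  refine (hasFDerivAt_const (0 : ℝ) z).congr_of_eventuallyEq ?_
  filter_upwards [he] with w hw
  simp [hw]

lemma locallyLipschitz_mul_comp {E : Type*} [NormedAddCommGroup E] [NormedSpace ℝ E] {s : Set E}
    (hs : IsOpen s) {φ u : E → ℝ} (hφ : ContDiff ℝ 1 φ) (hφs : tsupport φ ⊆ s)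
    (hu : LocallyLipschitzOn s u) {g : ℝ → ℝ} (hg : ∀ z ∈ s, ContDiffAt ℝ 1 g (u z)) :
    LocallyLipschitz fun z => φ z * g (u z) := by
  intro z
  by_cases hz : z ∈ tsupport φ
  · have hzs := hφs hz
    obtain ⟨K, t, ht, hK⟩ := hu hzs
    rw [hs.nhdsWithin_eq hzs] at ht
    obtain ⟨K', t', ht', hK'⟩ := (hg z hzs).exists_lipschitzOnWith
    have hc : ContinuousAt u z := hu.continuousOn.continuousAt (hs.mem_nhds hzs)
    have hK2 : LipschitzOnWith (K' * K) (fun z => g (u z)) (t ∩ u ⁻¹' t') :=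
      hK'.comp (hK.mono inter_subset_left) fun x hx => hx.2
    obtain ⟨K1, t1, ht1, hK1⟩ := hφ.locallyLipschitz z
    have ht2 : t ∩ u ⁻¹' t' ∈ nhds z := Filter.inter_mem ht (hc ht')
    have hgc : ContinuousAt (fun z => g (u z)) z := (hg z hzs).continuousAt.comp hc
    have hb1 : ∀ᶠ w in nhds z, |φ w| < |φ z| + 1 :=
      hφ.continuous.continuousAt.abs.eventually_lt continuousAt_const (by simp)
    have hb2 : ∀ᶠ w in nhds z, |g (u w)| < |g (u z)| + 1 :=
      hgc.abs.eventually_lt continuousAt_const (by simp)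
    refine ⟨Real.toNNReal (K1 * (|g (u z)| + 1) + (|φ z| + 1) * (K' * K : NNReal)), (t1 ∩ (t ∩ u ⁻¹' t')) ∩
      {w | |φ w| < |φ z| + 1 ∧ |g (u w)| < |g (u z)| + 1},
      Filter.inter_mem (Filter.inter_mem ht1 ht2) (hb1.and hb2),
      LipschitzOnWith.of_dist_le_mul fun x hx y hy => ?_⟩
    rw [Real.coe_toNNReal _ (by positivity)]
    have e1 := hK1.dist_le_mul x hx.1.1 y hy.1.1
    have e2 := hK2.dist_le_mul x hx.1.2 y hy.1.2
    rw [Real.dist_eq] at e1 e2 ⊢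
    have hsplit : φ x * g (u x) - φ y * g (u y) =
        (φ x - φ y) * g (u x) + φ y * (g (u x) - g (u y)) := by ring
    rw [hsplit]
    refine (abs_add_le _ _).trans ?_
    rw [abs_mul, abs_mul]
    have f1 : |φ x - φ y| * |g (u x)| ≤ (K1 * dist x y) * (|g (u z)| + 1) :=
      mul_le_mul e1 hx.2.2.le (abs_nonneg _) (by positivity)
    have f2 : |φ y| * |g (u x) - g (u y)| ≤ (|φ z| + 1) * ((K' * K : NNReal) * dist x y) :=
      mul_le_mul hy.2.1.le e2 (abs_nonneg _) (by positivity)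
    linarith
  · have he := notMem_tsupport_iff_eventuallyEq.1 hz
    refine ⟨0, {w | φ w = 0}, he, LipschitzOnWith.of_dist_le_mul fun x hx y hy => ?_⟩
    rw [mem_ofPred_eq] at hx hy
    simp [hx, hy]

/-- Energy inequality obtained from the test function `φ h(u)`. -/
lemma IsWeakSol.integral_mul_rpow_le {N : ℕ} {m q : ℝ} (hq : 0 < q) {a : Euc N → ℝ}
    (haLip : LocallyLipschitz a) (haPos : ∀ᵐ x, 0 < a x)
    [IsFiniteMeasureOnCompacts (muS a)]
    {u : Euc N × ℝ → ℝ} {gu : Euc N × ℝ → Euc N} {ut : Euc N × ℝ → ℝ}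
    (hu : IsWeakSol N 2 m q (fun _ => 1) (fun _ => m) a u gu ut)
    {h h' H : ℝ → ℝ} (hh : ∀ s, 0 ≤ s → HasDerivAt h (h' s) s)
    (hH : ∀ s, 0 ≤ s → HasDerivAt H (h s) s)
    (hhC : ∀ s, 0 ≤ s → ContDiffAt ℝ 1 h s) (hHC : ∀ s, 0 ≤ s → ContDiffAt ℝ 1 H s)
    (hh1 : ∀ s, 0 ≤ s → 1 ≤ h s)
    {φ : Euc N × ℝ → ℝ} {gφ : Euc N × ℝ → Euc N} {tφ : Euc N × ℝ → ℝ}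
    (hφ : ContDiff ℝ 1 φ) (hφ0 : ∀ z, 0 ≤ φ z) (hφc : HasCompactSupport φ)
    (hφS : tsupport φ ⊆ Sset N) (hφd : ∀ z, HasFDerivAt φ (pairCLM (gφ z) (tφ z)) z)
    {B : Euc N × ℝ → ℝ} (hB : Integrable B (muS a)) (hB0 : ∀ z, 0 ≤ B z)
    (hBx : ∀ z ∈ Sset N, ∀ y : Euc N,
      m * u z ^ (m - 1) * (h (u z) * ⟪gφ z, y⟫ + φ z * h' (u z) * ‖y‖ ^ 2) ≤ B z)
    (hBt : ∀ z ∈ Sset N, -(tφ z * H (u z)) ≤ B z) :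
    ∫ z, φ z * u z ^ q ∂(muS a) ≤ 2 * ∫ z, B z ∂(muS a) := by
  have ham : Measurable a := haLip.continuous.measurable
  have hSo := isOpen_Sset N
  have huc := hu.locLip.continuousOn
  have hu0 := hu.nonneg
  have haeS : ∀ᵐ z ∂(muS a), z ∈ Sset N := by
    rw [ae_muS_iff ham haPos]
    exact ae_restrict_mem hSo.measurableSet
  have huD : ∀ᵐ z, z ∈ Sset N → HasFDerivAt u (pairCLM (gu z) (ut z)) z := by
    rw [← ae_restrict_iff' hSo.measurableSet]
    filter_upwards [hu.deriv_ae, hu.locLip.ae_differentiableAt volume hSo] with z h1 h2 using h1 h2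
  have hD : ∀ g g' : ℝ → ℝ, (∀ s, 0 ≤ s → HasDerivAt g (g' s) s) → ∀ᵐ z, HasFDerivAt
      (fun z => φ z * g (u z)) (pairCLM (g (u z) • gφ z + (φ z * g' (u z)) • gu z)
        (g (u z) * tφ z + φ z * g' (u z) * ut z)) z := by
    intro g g' hg
    filter_upwards [huD] with z hz
    by_cases hzS : z ∈ Sset N
    · exact hasFDerivAt_mul_comp (hφd z) (hz hzS) (hg _ (hu0 z hzS))
    · exact hasFDerivAt_mul_comp_of_notMem_tsupport (hφd z) fun h => hzS (hφS h)
  have hInt : ∀ f v : Euc N × ℝ → ℝ, Continuous f → HasCompactSupport f → tsupport f ⊆ Sset N →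
      ContinuousOn v (Sset N) → Integrable (fun z => f z * v z) (muS a) :=
    fun f v hf hfc hfS hv => (continuous_mul_of_tsupport_subset hSo hf hfS hv
      ).integrable_of_hasCompactSupport hfc.mul_right
  have hcomp : ∀ g : ℝ → ℝ, (∀ s, 0 ≤ s → ContinuousAt g s) →
      ContinuousOn (fun z => g (u z)) (Sset N) := fun g hg z hz =>
    ContinuousAt.comp_continuousWithinAt (g := g) (hg _ (hu0 z hz)) (huc z hz)
  have hqc : ∀ s : ℝ, 0 ≤ s → ContinuousAt (fun s => s ^ q) s := fun s _ =>
    Real.continuousAt_rpow_const _ _ (Or.inr hq.le)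
  have htφ : tφ = fun z => fderiv ℝ φ z (0, 1) := by
    ext z
    rw [(hφd z).fderiv, pairCLM_apply]
    simp
  have htφc : Continuous tφ := by
    rw [htφ]
    exact (hφ.continuous_fderiv (by simp)).clm_apply continuous_const
  have htφs : tsupport tφ ⊆ tsupport φ := by
    refine closure_minimal (fun z hz => ?_) (isClosed_tsupport φ)
    refine tsupport_fderiv_subset ℝ (subset_tsupport _ fun h0 => hz ?_)
    rw [htφ]
    simp [h0]
  have htH : Integrable (fun z => tφ z * H (u z)) (muS a) :=
    hInt tφ _ htφc (hφc.mono' ((subset_tsupport _).trans htφs)) (htφs.trans hφS)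
      (hcomp H fun s hs => (hHC s hs).continuousAt)
  have hw := hu.weak_ineq (fun z => φ z * h (u z))
    (fun z => h (u z) • gφ z + (φ z * h' (u z)) • gu z)
    (fun z => h (u z) * tφ z + φ z * h' (u z) * ut z) (fun z => ?_)
    (locallyLipschitz_mul_comp hSo hφ hφS hu.locLip fun z hz => hhC _ (hu0 z hz))
    hφc.mul_right ((tsupport_mul_subset_left).trans hφS)
    ((hD h h' hh).mono fun z hz _ => hz)
  swap
  · by_cases hz : z ∈ Sset N
    · exact mul_nonneg (hφ0 z) (zero_le_one.trans (hh1 _ (hu0 z hz)))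
    · rw [image_eq_zero_of_notMem_tsupport fun h => hz (hφS h), zero_mul]
  simp only [mul_one, sub_self, Real.rpow_zero] at hw
  have hl : ∫ z, φ z * u z ^ q ∂(muS a) ≤ ∫ z, φ z * h (u z) * u z ^ q ∂(muS a) := by
    refine integral_mono_ae (hInt φ _ hφ.continuous hφc hφS (hcomp _ hqc)) ?_ ?_
    · simp only [mul_assoc]
      exact hInt φ _ hφ.continuous hφc hφS
        ((hcomp h fun s hs => (hhC s hs).continuousAt).mul (hcomp _ hqc))
    · filter_upwards [haeS] with z hz
      have := Real.rpow_nonneg (hu0 z hz) q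
      have h1 := hh1 _ (hu0 z hz)
      have h2 := hφ0 z
      nlinarith [mul_nonneg h2 this]
  have hBi : 0 ≤ ∫ z, B z ∂(muS a) := integral_nonneg hB0
  have hx : ∫ z, ⟪h (u z) • gφ z + (φ z * h' (u z)) • gu z, gu z⟫ * u z ^ (m - 1) * m ∂(muS a)
      ≤ ∫ z, B z ∂(muS a) := by
    by_cases hi : Integrable (fun z => ⟪h (u z) • gφ z + (φ z * h' (u z)) • gu z, gu z⟫ *
      u z ^ (m - 1) * m) (muS a)
    · refine integral_mono_ae hi hB ?_
      filter_upwards [haeS] with z hz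
      refine le_trans (le_of_eq ?_) (hBx z hz (gu z))
      rw [inner_add_left, real_inner_smul_left, real_inner_smul_left, real_inner_self_eq_norm_sq]
      ring
    · rwa [integral_undef hi]
  have ht : -∫ z, (h (u z) * tφ z + φ z * h' (u z) * ut z) * u z ∂(muS a)
      ≤ ∫ z, B z ∂(muS a) := by
    by_cases hi : Integrable (fun z => (h (u z) * tφ z + φ z * h' (u z) * ut z) * u z) (muS a)
    · have hG : ∀ s, 0 ≤ s → HasDerivAt (fun s => h s * s - H s) (h' s * s) s := fun s hs =>
        (((hh s hs).mul (hasDerivAt_id s)).sub (hH s hs)).congr_deriv (by simp)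
      have hΘ := integral_timeDeriv_mul_eq_zero haLip
        (locallyLipschitz_mul_comp hSo hφ hφS hu.locLip (g := fun s => h s * s - H s)
          fun z hz => ((hhC _ (hu0 z hz)).mul contDiffAt_id).sub (hHC _ (hu0 z hz)))
        hφc.mul_right (hD _ _ hG)
      have hΘ' : ∫ z, ((h (u z) * tφ z + φ z * h' (u z) * ut z) * u z - tφ z * H (u z)) ∂(muS a)
          = 0 := by
        rw [integral_muS ham haPos, ← hΘ, ← integral_indicator hSo.measurableSet]
        refine integral_congr_ae (ae_of_all _ fun z => ?_)
        by_cases hz : z ∈ Sset N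
        · rw [indicator_of_mem hz]
          ring
        · rw [indicator_of_notMem hz]
          have h1 : tφ z = 0 :=
            image_eq_zero_of_notMem_tsupport fun h => hz (hφS (htφs h))
          have h2 : φ z = 0 := image_eq_zero_of_notMem_tsupport fun h => hz (hφS h)
          simp [h1, h2]
      rw [integral_sub hi htH, sub_eq_zero] at hΘ'
      rw [hΘ', ← integral_neg]
      refine integral_mono_ae htH.neg hB ?_
      filter_upwards [haeS] with z hz using hBt z hz
    · rwa [integral_undef hi, neg_zero]
  linarith

/-- The rescaled right-hand side of the energy inequality. -/
def youngFun (m d μ w : ℝ) : ℝ := w ^ (m - 1) * (μ * (1 + w / μ) ^ (1 + d)) + w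

lemma youngFun_le_of_le {m d μ w W : ℝ} (hm : 1 ≤ m) (hd : 0 < d) (hμ : 0 < μ) (hw : 0 ≤ w)
    (hW : w ≤ W) : youngFun m d μ w ≤ youngFun m d μ W := by
  have hm' : 0 ≤ m - 1 := by linarith
  have hW0 : 0 ≤ W := hw.trans hW
  unfold youngFun
  gcongr

lemma youngFun_le_mul_rpow {m d q μ w W : ℝ} (hm : 1 ≤ m) (hd : 0 < d) (hq : m + d < q)
    (hμ : 0 < μ) (hW : 0 < W) (hμW : μ ≤ W) (hw : W ≤ w) :
    youngFun m d μ w ≤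
      (2 ^ (1 + d) * μ ^ (-d) * W ^ (m + d - q) + W ^ (1 - q)) * w ^ q := by
  have hw0 : 0 < w := hW.trans_le hw
  have h1 : 1 + w / μ ≤ 2 * w / μ := by
    rw [← sub_nonneg]
    have : 2 * w / μ - (1 + w / μ) = (w - μ) / μ := by field_simp; ring
    rw [this]
    exact div_nonneg (by linarith) hμ.le
  have h2 : (1 + w / μ) ^ (1 + d) ≤ 2 ^ (1 + d) * w ^ (1 + d) * μ ^ (-(1 + d)) := by
    refine (Real.rpow_le_rpow (by positivity) h1 (by linarith)).trans (le_of_eq ?_)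
    rw [Real.div_rpow (by positivity) hμ.le, Real.mul_rpow (by norm_num) hw0.le,
      Real.rpow_neg hμ.le, div_eq_mul_inv]
  have h3 : w ^ (m - 1) * (μ * (2 ^ (1 + d) * w ^ (1 + d) * μ ^ (-(1 + d)))) =
      2 ^ (1 + d) * μ ^ (-d) * (w ^ (m + d - q) * w ^ q) := by
    have e1 : w ^ (m + d - q) * w ^ q = w ^ (m - 1) * w ^ (1 + d) := by
      rw [← Real.rpow_add hw0, ← Real.rpow_add hw0]
      ring_nf
    have e2 : μ ^ (-d) = μ * μ ^ (-(1 + d)) := by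
      nth_rewrite 2 [← Real.rpow_one μ]
      rw [← Real.rpow_add hμ]
      ring_nf
    rw [e1, e2]
    ring
  have h4 : w = w ^ (1 - q) * w ^ q := by
    rw [← Real.rpow_add hw0]
    simp
  have h5 : w ^ (m + d - q) ≤ W ^ (m + d - q) :=
    Real.rpow_le_rpow_of_nonpos hW hw (by linarith)
  have h6 : w ^ (1 - q) ≤ W ^ (1 - q) :=
    Real.rpow_le_rpow_of_nonpos hW hw (by linarith)
  have hwq : 0 < w ^ q := Real.rpow_pos_of_pos hw0 q
  have hc : 0 ≤ (2 : ℝ) ^ (1 + d) * μ ^ (-d) := by positivity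
  calc youngFun m d μ w
      ≤ w ^ (m - 1) * (μ * (2 ^ (1 + d) * w ^ (1 + d) * μ ^ (-(1 + d)))) + w := by
        unfold youngFun
        gcongr
    _ = 2 ^ (1 + d) * μ ^ (-d) * (w ^ (m + d - q) * w ^ q) + w ^ (1 - q) * w ^ q := by
        rw [h3, ← h4]
    _ ≤ 2 ^ (1 + d) * μ ^ (-d) * (W ^ (m + d - q) * w ^ q) + W ^ (1 - q) * w ^ q := by
        gcongr
    _ = _ := by ring

lemma exists_youngFun_one_le {m d q δ : ℝ} (hm : 1 ≤ m) (hd : 0 < d) (hq : m + d < q)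
    (hδ : 0 < δ) : ∃ C, 0 ≤ C ∧ ∀ w, 0 ≤ w → youngFun m d 1 w ≤ C + δ * w ^ q := by
  have ht : Filter.Tendsto
      (fun W : ℝ => 2 ^ (1 + d) * 1 ^ (-d) * W ^ (m + d - q) + W ^ (1 - q)) Filter.atTop
      (nhds (2 ^ (1 + d) * 1 ^ (-d) * 0 + 0)) := by
    have e1 := tendsto_rpow_neg_atTop (y := q - (m + d)) (by linarith)
    have e2 := tendsto_rpow_neg_atTop (y := q - 1) (by linarith)
    simp only [neg_sub] at e1 e2
    exact (e1.const_mul _).add e2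
  rw [mul_zero, add_zero] at ht
  obtain ⟨W, hWδ, hW⟩ := ((ht.eventually_lt_const hδ).and
    (Filter.eventually_ge_atTop 1)).exists
  have hW0 : 0 < W := by linarith
  refine ⟨youngFun m d 1 W, by unfold youngFun; positivity, fun w hw => ?_⟩
  have hwq : 0 ≤ w ^ q := Real.rpow_nonneg hw q
  rcases le_total w W with h | h
  · have := youngFun_le_of_le hm hd one_pos hw h
    nlinarith
  · have h1 := youngFun_le_mul_rpow hm hd hq one_pos hW0 hW h
    have h2 : 0 ≤ youngFun m d 1 W := by unfold youngFun; positivity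
    nlinarith

lemma exists_youngFun_le {m d q η : ℝ} (hm : 1 ≤ m) (hd : 0 < d) (hq : m + d < q)
    (hη : 0 < η) : ∃ μ K, 0 < μ ∧ 0 ≤ K ∧ ∀ w, 0 ≤ w → youngFun m d μ w ≤ η + K * w ^ q := by
  set c : ℝ := 2 ^ (1 + d) + 1 with hc
  have hc0 : 0 < c := by positivity
  set μ := min 1 (η / c) with hμd
  have hμ : 0 < μ := by positivity
  have hμ1 : μ ≤ 1 := min_le_left _ _
  have hμη : μ * c ≤ η := by
    rw [← le_div_iff₀ hc0]
    exact min_le_right _ _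
  refine ⟨μ, 2 ^ (1 + d) * μ ^ (-d) * μ ^ (m + d - q) + μ ^ (1 - q), hμ, by positivity,
    fun w hw => ?_⟩
  have hwq : 0 ≤ w ^ q := Real.rpow_nonneg hw q
  rcases le_total w μ with h | h
  · have h1 := youngFun_le_of_le hm hd hμ hw h
    have h2 : youngFun m d μ μ ≤ μ * c := by
      unfold youngFun
      rw [div_self hμ.ne', one_add_one_eq_two]
      have h3 : μ ^ (m - 1) ≤ 1 := Real.rpow_le_one hμ.le hμ1 (by linarith)
      have h4 : μ ^ (m - 1) * (μ * 2 ^ (1 + d)) ≤ 1 * (μ * 2 ^ (1 + d)) := by gcongr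
      rw [hc]
      linarith
    have h5 : 0 ≤ (2 ^ (1 + d) * μ ^ (-d) * μ ^ (m + d - q) + μ ^ (1 - q)) * w ^ q := by
      positivity
    linarith
  · have h1 := youngFun_le_mul_rpow hm hd hq hμ hμ le_rfl h
    linarith

/-- The one-dimensional smooth cutoff: `1` on `(-∞, 1]` and `0` on `[2, ∞)`. -/
def cutoff (s : ℝ) : ℝ := smoothTransition (2 - s)

lemma contDiff_cutoff : ContDiff ℝ 1 cutoff :=
  smoothTransition.contDiff (n := 1) |>.comp (contDiff_const.sub contDiff_id)

lemma cutoff_nonneg (s : ℝ) : 0 ≤ cutoff s := smoothTransition.nonneg _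

lemma cutoff_le_one (s : ℝ) : cutoff s ≤ 1 := smoothTransition.le_one _

lemma cutoff_eq_one {s : ℝ} (hs : s ≤ 1) : cutoff s = 1 :=
  smoothTransition.one_of_one_le (by linarith)

lemma cutoff_eq_zero {s : ℝ} (hs : 2 ≤ s) : cutoff s = 0 :=
  smoothTransition.zero_of_nonpos (by linarith)

lemma deriv_cutoff_eq_zero_of_le {s : ℝ} (hs : s ≤ 1) : deriv cutoff s = 0 :=
  IsLocalMax.deriv_eq_zero (Filter.Eventually.of_forall fun t => by
    rw [cutoff_eq_one hs]
    exact cutoff_le_one t)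

lemma deriv_cutoff_eq_zero_of_ge {s : ℝ} (hs : 2 ≤ s) : deriv cutoff s = 0 :=
  IsLocalMin.deriv_eq_zero (Filter.Eventually.of_forall fun t => by
    rw [cutoff_eq_zero hs]
    exact cutoff_nonneg t)

lemma exists_abs_deriv_cutoff_le : ∃ P, 0 ≤ P ∧ ∀ s, |deriv cutoff s| ≤ P := by
  obtain ⟨P, hP⟩ := (isCompact_Icc (a := (1 : ℝ)) (b := 2)).exists_bound_of_continuousOn
    (contDiff_cutoff.continuous_deriv le_rfl).continuousOn
  have hP0 : 0 ≤ P := (norm_nonneg _).trans (hP 1 (by norm_num))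
  refine ⟨P, hP0, fun s => ?_⟩
  rcases le_total s 1 with h | h
  · rwa [deriv_cutoff_eq_zero_of_le h, abs_zero]
  rcases le_total 2 s with h' | h'
  · rwa [deriv_cutoff_eq_zero_of_ge h', abs_zero]
  · exact hP s ⟨h, h'⟩

/-- The bounded decreasing nonlinearity used in the test function. -/
def testNonlin (d ε s : ℝ) : ℝ := 1 + (1 + s / ε) ^ (-d)

/-- The derivative of `testNonlin`. -/
def testNonlinDeriv (d ε s : ℝ) : ℝ := -(d / ε * (1 + s / ε) ^ (-d - 1))

/-- The primitive of `testNonlin` vanishing at `0`. -/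
def testNonlinPrim (d ε s : ℝ) : ℝ := s + ε / (1 - d) * ((1 + s / ε) ^ (1 - d) - 1)

lemma hasDerivAt_testNonlin {d ε s : ℝ} (hε : 0 < ε) (hs : 0 ≤ s) :
    HasDerivAt (testNonlin d ε) (testNonlinDeriv d ε s) s := by
  have hp : 0 < 1 + s / ε := by positivity
  have h := (((((hasDerivAt_id s).div_const ε).const_add 1).rpow_const (p := -d)
    (Or.inl hp.ne')).const_add 1)
  refine h.congr_deriv ?_
  simp only [testNonlinDeriv, id]
  ring

lemma hasDerivAt_testNonlinPrim {d ε s : ℝ} (hε : 0 < ε) (hd : d < 1) (hs : 0 ≤ s) :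
    HasDerivAt (testNonlinPrim d ε) (testNonlin d ε s) s := by
  have hp : 0 < 1 + s / ε := by positivity
  have h := (hasDerivAt_id s).add ((((((hasDerivAt_id s).div_const ε).const_add 1).rpow_const
    (p := 1 - d) (Or.inl hp.ne')).sub_const 1).const_mul (ε / (1 - d)))
  refine h.congr_deriv ?_
  have h1 : 1 - d ≠ 0 := by linarith
  simp only [testNonlin, id]
  rw [show 1 - d - 1 = -d by ring]
  field_simp

lemma contDiffAt_testNonlin {d ε s : ℝ} (hε : 0 < ε) (hs : 0 ≤ s) :
    ContDiffAt ℝ 1 (testNonlin d ε) s := by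
  have hp : 0 < 1 + s / ε := by positivity
  exact contDiffAt_const.add
    ((contDiffAt_const.add (contDiffAt_id.div_const ε)).rpow_const_of_ne hp.ne')

lemma contDiffAt_testNonlinPrim {d ε s : ℝ} (hε : 0 < ε) (hs : 0 ≤ s) :
    ContDiffAt ℝ 1 (testNonlinPrim d ε) s := by
  have hp : 0 < 1 + s / ε := by positivity
  exact contDiffAt_id.add (contDiffAt_const.mul
    (((contDiffAt_const.add (contDiffAt_id.div_const ε)).rpow_const_of_ne hp.ne').sub
      contDiffAt_const))

lemma one_le_testNonlin {d ε s : ℝ} (hε : 0 < ε) (hs : 0 ≤ s) : 1 ≤ testNonlin d ε s := by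
  have : 0 ≤ (1 + s / ε) ^ (-d) := by positivity
  unfold testNonlin
  linarith

lemma testNonlin_le_two {d ε s : ℝ} (hd : 0 < d) (hε : 0 < ε) (hs : 0 ≤ s) :
    testNonlin d ε s ≤ 2 := by
  have h0 : 0 ≤ s / ε := by positivity
  have : (1 + s / ε) ^ (-d) ≤ 1 :=
    Real.rpow_le_one_of_one_le_of_nonpos (by linarith) (by linarith)
  unfold testNonlin
  linarith

lemma testNonlinPrim_nonneg {d ε s : ℝ} (hε : 0 < ε) (hd : d < 1) (hs : 0 ≤ s) :
    0 ≤ testNonlinPrim d ε s := by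
  have h0 : 0 ≤ s / ε := by positivity
  have h1 : 1 ≤ (1 + s / ε) ^ (1 - d) := Real.one_le_rpow (by linarith) (by linarith)
  have h2 : 0 < 1 - d := by linarith
  have h3 : 0 ≤ ε / (1 - d) * ((1 + s / ε) ^ (1 - d) - 1) :=
    mul_nonneg (by positivity) (by linarith)
  unfold testNonlinPrim
  linarith

lemma testNonlinPrim_le {d ε s : ℝ} (hε : 0 < ε) (hd0 : 0 < d) (hd : d < 1) (hs : 0 ≤ s) :
    testNonlinPrim d ε s ≤ 2 * s := by
  have h0 : 0 ≤ s / ε := by positivity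
  have h2 : 0 < 1 - d := by linarith
  have h1 := rpow_one_add_le_one_add_mul_self (s := s / ε) (p := 1 - d) (by linarith) h2.le
    (by linarith)
  have h3 : ε / (1 - d) * ((1 + s / ε) ^ (1 - d) - 1) ≤ ε / (1 - d) * ((1 - d) * (s / ε)) :=
    mul_le_mul_of_nonneg_left (by linarith) (by positivity)
  have h4 : ε / (1 - d) * ((1 - d) * (s / ε)) = s := by field_simp
  unfold testNonlinPrim
  linarith

/-- Absorption of the power of the cutoff in `youngFun`. -/
lemma pow_mul_le_youngFun {m d q μ v ξ : ℝ} {j : ℕ} (hm : 1 ≤ m) (hd : 0 < d) (hq : m + d < q)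
    (hμ : 0 < μ) (hv : 0 ≤ v) (hξ0 : 0 ≤ ξ) (hξ1 : ξ ≤ 1) (hj : (j + 2) * (m + d) / q ≤ j) :
    ξ ^ j * (v ^ (m - 1) * (μ * (1 + v / μ) ^ (1 + d))) ≤
        youngFun m d μ (ξ ^ ((j + 2) / q : ℝ) * v) ∧
      ξ ^ (j + 1) * v ≤ youngFun m d μ (ξ ^ ((j + 2) / q : ℝ) * v) := by
  have hq0 : 0 < q := by linarith
  set σ : ℝ := ξ ^ ((j + 2) / q : ℝ) with hσ
  have hσ0 : 0 ≤ σ := Real.rpow_nonneg hξ0 _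
  have hσ1 : σ ≤ 1 := Real.rpow_le_one hξ0 hξ1 (by positivity)
  have hkey : ξ ^ j ≤ σ ^ (m + d) := by
    rw [hσ, ← Real.rpow_mul hξ0, ← Real.rpow_natCast]
    have hp : 0 < (j + 2 : ℝ) / q * (m + d) := by positivity
    rcases hξ0.eq_or_lt with h | h
    · have hj0 : (0 : ℝ) < j := lt_of_lt_of_le (by positivity) hj
      rw [← h, Real.zero_rpow hj0.ne', Real.zero_rpow hp.ne']
    · exact Real.rpow_le_rpow_of_exponent_ge h hξ1 (by rw [div_mul_eq_mul_div]; exact hj)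
  have hw0 : 0 ≤ σ * v := by positivity
  have hfirst : ξ ^ j * (v ^ (m - 1) * (μ * (1 + v / μ) ^ (1 + d))) ≤
      (σ * v) ^ (m - 1) * (μ * (1 + σ * v / μ) ^ (1 + d)) := by
    have e1 : σ ^ (m + d) = σ ^ (m - 1) * σ ^ (1 + d) := by
      rw [← Real.rpow_add_of_nonneg hσ0 (by linarith) (by linarith)]
      ring_nf
    have hb : σ * (1 + v / μ) ≤ 1 + σ * v / μ := by
      rw [mul_add, mul_one, mul_div_assoc]
      linarith
    have hv1 : 0 ≤ 1 + v / μ := by positivity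
    calc ξ ^ j * (v ^ (m - 1) * (μ * (1 + v / μ) ^ (1 + d)))
        ≤ σ ^ (m + d) * (v ^ (m - 1) * (μ * (1 + v / μ) ^ (1 + d))) := by gcongr
      _ = (σ * v) ^ (m - 1) * (μ * (σ * (1 + v / μ)) ^ (1 + d)) := by
          rw [e1, Real.mul_rpow hσ0 hv, Real.mul_rpow hσ0 hv1]
          ring
      _ ≤ _ := by gcongr
  have hpos : 0 ≤ (σ * v) ^ (m - 1) * (μ * (1 + σ * v / μ) ^ (1 + d)) := by positivity
  constructor
  · unfold youngFun
    linarith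
  · have h1 : σ ^ (m + d) ≤ σ := by
      have := Real.rpow_le_rpow_of_exponent_ge' hσ0 hσ1 zero_le_one (by linarith : 1 ≤ m + d)
      rwa [Real.rpow_one] at this
    have h2 : ξ ^ (j + 1) ≤ ξ ^ j := pow_le_pow_of_le_one hξ0 hξ1 (Nat.le_succ j)
    have h3 : ξ ^ (j + 1) * v ≤ σ * v := by
      gcongr
      linarith
    unfold youngFun
    linarith

lemma scaled_youngFun_le {m d q μ η K κ R U ξ χ : ℝ} {j : ℕ} (hm : 1 ≤ m) (hd : 0 < d)
    (hq : m + d < q) (hη : 0 ≤ η) (hF : ∀ w, 0 ≤ w → youngFun m d μ w ≤ η + K * w ^ q)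
    (hR : 0 < R) (hU : 0 ≤ U) (hξ0 : 0 ≤ ξ) (hχ0 : 0 ≤ χ) (hχ1 : χ ≤ 1) :
    χ * (R ^ (-(κ * q)) * youngFun m d μ (ξ ^ ((j + 2) / q : ℝ) * (R ^ κ * U))) ≤
      R ^ (-(κ * q)) * η + K * (ξ ^ (j + 2) * χ * U ^ q) := by
  have hq0 : 0 < q := by linarith
  have hw0 : 0 ≤ ξ ^ ((j + 2) / q : ℝ) * (R ^ κ * U) := by positivity
  have hwq : (ξ ^ ((j + 2) / q : ℝ) * (R ^ κ * U)) ^ q = ξ ^ (j + 2) * (R ^ (κ * q) * U ^ q) := by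
    rw [Real.mul_rpow (by positivity) (by positivity), Real.mul_rpow (by positivity) hU,
      ← Real.rpow_mul hξ0, ← Real.rpow_mul hR.le, div_mul_cancel₀ _ hq0.ne']
    congr 1
    exact_mod_cast Real.rpow_natCast ξ (j + 2)
  have hRR : R ^ (-(κ * q)) * R ^ (κ * q) = 1 := by
    rw [← Real.rpow_add hR]
    simp
  have hRp : 0 < R ^ (-(κ * q)) := by positivity
  have h1 := hF _ hw0
  rw [hwq] at h1
  calc χ * (R ^ (-(κ * q)) * youngFun m d μ (ξ ^ ((j + 2) / q : ℝ) * (R ^ κ * U)))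
      ≤ χ * (R ^ (-(κ * q)) * (η + K * (ξ ^ (j + 2) * (R ^ (κ * q) * U ^ q)))) := by gcongr
    _ = χ * (R ^ (-(κ * q)) * η) +
        (R ^ (-(κ * q)) * R ^ (κ * q)) * (K * (ξ ^ (j + 2) * χ * U ^ q)) := by ring
    _ ≤ 1 * (R ^ (-(κ * q)) * η) + 1 * (K * (ξ ^ (j + 2) * χ * U ^ q)) := by
        rw [hRR]
        gcongr
    _ = _ := by ring

/-- Pointwise control of the diffusion term in the energy inequality. -/
lemma diffusion_term_le {N : ℕ} {m d q μ η K κ R P U ξ χ : ℝ} {j : ℕ} {g y : Euc N} (hm : 1 ≤ m)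
    (hd : 0 < d) (hq : m + d < q) (hμ : 0 < μ) (hη : 0 ≤ η)
    (hF : ∀ w, 0 ≤ w → youngFun m d μ w ≤ η + K * w ^ q) (hκ : κ * (q - m) = 2) (hR : 0 < R)
    (hU : 0 ≤ U) (hξ0 : 0 ≤ ξ) (hξ1 : ξ ≤ 1) (hχ0 : 0 ≤ χ) (hχ1 : χ ≤ 1)
    (hj : (j + 2) * (m + d) / q ≤ j) (hg : ‖g‖ ≤ P / R * (ξ ^ (j + 1) * χ)) :
    m * U ^ (m - 1) * (testNonlin d (μ * R ^ (-κ)) U * ⟪g, y⟫ +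
        ξ ^ (j + 2) * χ * testNonlinDeriv d (μ * R ^ (-κ)) U * ‖y‖ ^ 2) ≤
      m * P ^ 2 / d * (R ^ (-(κ * q)) * η + K * (ξ ^ (j + 2) * χ * U ^ q)) := by
  set ε := μ * R ^ (-κ) with hε
  have hε0 : 0 < ε := by positivity
  set L := d / ε * (1 + U / ε) ^ (-d - 1) with hL
  have hLpos : 0 < L := by positivity
  have hLinv : L⁻¹ = ε / d * (1 + U / ε) ^ (1 + d) := by
    rw [hL, mul_inv, inv_div, ← Real.rpow_neg (by positivity)]
    ring_nf
  have hdef : testNonlinDeriv d ε U = -L := rfl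
  have hUm : 0 ≤ U ^ (m - 1) := by positivity
  have hin : testNonlin d ε U * ⟪g, y⟫ ≤ 2 * (P / R * (ξ ^ (j + 1) * χ) * ‖y‖) := by
    have h1 : ⟪g, y⟫ ≤ P / R * (ξ ^ (j + 1) * χ) * ‖y‖ :=
      (real_inner_le_norm g y).trans (by gcongr)
    have h2 := one_le_testNonlin (d := d) hε0 hU
    have h3 := testNonlin_le_two hd hε0 hU
    have h4 : 0 ≤ P / R * (ξ ^ (j + 1) * χ) * ‖y‖ :=
      mul_nonneg ((norm_nonneg g).trans hg) (norm_nonneg y)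
    nlinarith
  have hsq : 2 * (P / R * (ξ ^ (j + 1) * χ) * ‖y‖) + ξ ^ (j + 2) * χ * (-L) * ‖y‖ ^ 2 ≤
      χ * ξ ^ j * ((P / R) ^ 2 * L⁻¹) := by
    have h1 : 2 * (P / R) * (ξ * ‖y‖) - L * (ξ * ‖y‖) ^ 2 ≤ (P / R) ^ 2 * L⁻¹ := by
      rw [← div_eq_mul_inv, le_div_iff₀ hLpos]
      nlinarith [sq_nonneg (P / R - L * (ξ * ‖y‖))]
    calc _ = χ * ξ ^ j * (2 * (P / R) * (ξ * ‖y‖) - L * (ξ * ‖y‖) ^ 2) := by ring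
      _ ≤ _ := by gcongr
  have hscale : U ^ (m - 1) * ((P / R) ^ 2 * L⁻¹) =
      P ^ 2 / d * (R ^ (-(κ * q)) *
        ((R ^ κ * U) ^ (m - 1) * (μ * (1 + R ^ κ * U / μ) ^ (1 + d)))) := by
    have e1 : U / ε = R ^ κ * U / μ := by
      rw [hε, Real.rpow_neg hR.le]
      field_simp
    have e2 : R ^ (-(κ * q)) * (R ^ κ) ^ (m - 1) = R ^ (-κ) * (R ^ 2)⁻¹ := by
      rw [← Real.rpow_mul hR.le, ← Real.rpow_add hR, ← Real.rpow_natCast R 2,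
        ← Real.rpow_neg hR.le, ← Real.rpow_add hR]
      congr 1
      push_cast
      linarith
    rw [hLinv, e1, Real.mul_rpow (by positivity) hU]
    calc _ = P ^ 2 / d * ((R ^ (-κ) * (R ^ 2)⁻¹) *
          (U ^ (m - 1) * (μ * (1 + R ^ κ * U / μ) ^ (1 + d)))) := by
          rw [hε]
          ring
      _ = _ := by
          rw [← e2]
          ring
  have hy := (pow_mul_le_youngFun (v := R ^ κ * U) hm hd hq hμ (by positivity) hξ0 hξ1 hj).1
  have hs := scaled_youngFun_le (κ := κ) (j := j) hm hd hq hη hF hR hU hξ0 hχ0 hχ1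
  have hRp : 0 < R ^ (-(κ * q)) := by positivity
  rw [hdef]
  calc _ ≤ m * U ^ (m - 1) * (χ * ξ ^ j * ((P / R) ^ 2 * L⁻¹)) := by
        gcongr
        linarith
    _ = m * (χ * ξ ^ j * (U ^ (m - 1) * ((P / R) ^ 2 * L⁻¹))) := by ring
    _ = m * P ^ 2 / d * (χ * (R ^ (-(κ * q)) *
        (ξ ^ j * ((R ^ κ * U) ^ (m - 1) * (μ * (1 + R ^ κ * U / μ) ^ (1 + d)))))) := by
        rw [hscale]
        ring
    _ ≤ m * P ^ 2 / d * (χ * (R ^ (-(κ * q)) *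
        youngFun m d μ (ξ ^ ((j + 2) / q : ℝ) * (R ^ κ * U)))) := by gcongr
    _ ≤ _ := by gcongr

/-- Pointwise control of the time-derivative term in the energy inequality. -/
lemma time_term_le {m d q μ η K κ R P U ξ χ τ : ℝ} {j : ℕ} (hm : 1 ≤ m) (hd : 0 < d)
    (hd1 : d < 1) (hq : m + d < q) (hμ : 0 < μ) (hη : 0 ≤ η)
    (hF : ∀ w, 0 ≤ w → youngFun m d μ w ≤ η + K * w ^ q) (hR : 0 < R) (hP : 0 ≤ P)
    (hU : 0 ≤ U) (hξ0 : 0 ≤ ξ) (hξ1 : ξ ≤ 1) (hχ0 : 0 ≤ χ) (hχ1 : χ ≤ 1)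
    (hj : (j + 2) * (m + d) / q ≤ j) (hτ : -τ ≤ P / R ^ (κ * (q - 1)) * (ξ ^ (j + 1) * χ)) :
    -(τ * testNonlinPrim d (μ * R ^ (-κ)) U) ≤
      2 * P * (R ^ (-(κ * q)) * η + K * (ξ ^ (j + 2) * χ * U ^ q)) := by
  have hε0 : 0 < μ * R ^ (-κ) := by positivity
  have h1 := testNonlinPrim_nonneg hε0 hd1 hU
  have h2 := testNonlinPrim_le hε0 hd hd1 hU
  have hscale : U / R ^ (κ * (q - 1)) = R ^ (-(κ * q)) * (R ^ κ * U) := by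
    rw [div_eq_inv_mul, ← Real.rpow_neg hR.le, ← mul_assoc, ← Real.rpow_add hR]
    ring_nf
  have hy := (pow_mul_le_youngFun (v := R ^ κ * U) hm hd hq hμ (by positivity) hξ0 hξ1 hj).2
  have hs := scaled_youngFun_le (κ := κ) (j := j) hm hd hq hη hF hR hU hξ0 hχ0 hχ1
  have hRp : 0 < R ^ (-(κ * q)) := by positivity
  calc -(τ * testNonlinPrim d (μ * R ^ (-κ)) U)
      = -τ * testNonlinPrim d (μ * R ^ (-κ)) U := by ring
    _ ≤ P / R ^ (κ * (q - 1)) * (ξ ^ (j + 1) * χ) * (2 * U) := by gcongr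
    _ = 2 * P * (χ * (ξ ^ (j + 1) * (U / R ^ (κ * (q - 1))))) := by ring
    _ = 2 * P * (χ * (R ^ (-(κ * q)) * (ξ ^ (j + 1) * (R ^ κ * U)))) := by
        rw [hscale]
        ring
    _ ≤ 2 * P * (χ * (R ^ (-(κ * q)) *
        youngFun m d μ (ξ ^ ((j + 2) / q : ℝ) * (R ^ κ * U)))) := by gcongr
    _ ≤ _ := by gcongr

/-- Smooth cutoff of the space-time cylinder `{‖x‖ ≤ R, t ≤ T}`. -/
def cylCutoff {N : ℕ} (R T : ℝ) (z : Euc N × ℝ) : ℝ :=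
  cutoff (‖z.1‖ ^ 2 / R ^ 2) * cutoff (z.2 / T)

/-- Smooth cutoff away from the initial time. -/
def startCutoff (β t : ℝ) : ℝ := smoothTransition (t / β - 1)

/-- The space-time cutoff entering the test function. -/
def testCutoff {N : ℕ} (j : ℕ) (R T β : ℝ) (z : Euc N × ℝ) : ℝ :=
  cylCutoff R T z ^ (j + 2) * startCutoff β z.2

/-- The spatial gradient of `testCutoff`. -/
def testCutoffGrad {N : ℕ} (j : ℕ) (R T β : ℝ) (z : Euc N × ℝ) : Euc N :=
  ((j + 2 : ℝ) * cylCutoff R T z ^ (j + 1) * startCutoff β z.2 *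
    (cutoff (z.2 / T) * (deriv cutoff (‖z.1‖ ^ 2 / R ^ 2) * (2 / R ^ 2)))) • z.1

/-- The time derivative of `testCutoff`. -/
def testCutoffTime {N : ℕ} (j : ℕ) (R T β : ℝ) (z : Euc N × ℝ) : ℝ :=
  (j + 2 : ℝ) * cylCutoff R T z ^ (j + 1) * startCutoff β z.2 *
    (cutoff (‖z.1‖ ^ 2 / R ^ 2) * (deriv cutoff (z.2 / T) / T)) +
  cylCutoff R T z ^ (j + 2) * (deriv smoothTransition (z.2 / β - 1) / β)

section CutoffBounds

variable {N : ℕ} {R T β : ℝ} (j : ℕ) (z : Euc N × ℝ)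

lemma cylCutoff_nonneg : 0 ≤ cylCutoff R T z := mul_nonneg (cutoff_nonneg _) (cutoff_nonneg _)

lemma cylCutoff_le_one : cylCutoff R T z ≤ 1 :=
  mul_le_one₀ (cutoff_le_one _) (cutoff_nonneg _) (cutoff_le_one _)

lemma startCutoff_nonneg (t : ℝ) : 0 ≤ startCutoff β t := smoothTransition.nonneg _

lemma startCutoff_le_one (t : ℝ) : startCutoff β t ≤ 1 := smoothTransition.le_one _

lemma testCutoff_nonneg : 0 ≤ testCutoff j R T β z :=
  mul_nonneg (pow_nonneg (cylCutoff_nonneg z) _) (startCutoff_nonneg _)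

lemma testCutoff_le_one : testCutoff j R T β z ≤ 1 :=
  mul_le_one₀ (pow_le_one₀ (cylCutoff_nonneg z) (cylCutoff_le_one z)) (startCutoff_nonneg _)
    (startCutoff_le_one _)

variable {z}

lemma cylCutoff_eq_one (hR : 0 < R) (hT : 0 < T) (hx : ‖z.1‖ ≤ R) (ht : z.2 ≤ T) :
    cylCutoff R T z = 1 := by
  rw [cylCutoff, cutoff_eq_one, cutoff_eq_one, one_mul]
  · rwa [div_le_one hT]
  · rw [div_le_one (by positivity)]
    gcongr

lemma cylCutoff_eq_zero (hR : 0 < R) (hT : 0 < T) (hz : ¬(‖z.1‖ ≤ 2 * R ∧ z.2 ≤ 2 * T)) :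
    cylCutoff R T z = 0 := by
  rw [not_and_or, not_le, not_le] at hz
  rw [cylCutoff]
  rcases hz with h | h
  · rw [cutoff_eq_zero, zero_mul]
    rw [le_div_iff₀ (by positivity)]
    nlinarith
  · rw [cutoff_eq_zero (s := z.2 / T), mul_zero]
    rw [le_div_iff₀ hT]
    exact h.le

lemma testCutoff_eq_one (hR : 0 < R) (hT : 0 < T) (hβ : 0 < β) (hx : ‖z.1‖ ≤ R) (ht : z.2 ≤ T)
    (htβ : 2 * β ≤ z.2) : testCutoff j R T β z = 1 := by
  rw [testCutoff, cylCutoff_eq_one hR hT hx ht, one_pow, one_mul]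
  refine smoothTransition.one_of_one_le ?_
  rw [le_sub_iff_add_le, le_div_iff₀ hβ]
  linarith

lemma testCutoffGrad_eq_zero (hR : 0 < R) (hx : ‖z.1‖ ≤ R) : testCutoffGrad j R T β z = 0 := by
  rw [testCutoffGrad, deriv_cutoff_eq_zero_of_le]
  · simp
  · rw [div_le_one (by positivity)]
    gcongr

lemma deriv_smoothTransition_nonneg (s : ℝ) : 0 ≤ deriv smoothTransition s :=
  smoothTransition.monotone.deriv_nonneg

lemma testCutoffTime_nonneg (hT : 0 < T) (hβ : 0 < β) (ht : z.2 ≤ T) :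
    0 ≤ testCutoffTime j R T β z := by
  rw [testCutoffTime, deriv_cutoff_eq_zero_of_le (by rwa [div_le_one hT])]
  have h1 := cylCutoff_nonneg (R := R) (T := T) z
  have h2 := deriv_smoothTransition_nonneg (z.2 / β - 1)
  simp only [zero_div, mul_zero, zero_add]
  positivity

lemma norm_testCutoffGrad_le {P : ℝ} (hP : ∀ s, |deriv cutoff s| ≤ P) (hR : 0 < R) :
    ‖testCutoffGrad j R T β z‖ ≤
      4 * (j + 2) * P / R * (cylCutoff R T z ^ (j + 1) * startCutoff β z.2) := by
  have h1 := cylCutoff_nonneg (R := R) (T := T) z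
  have h2 := startCutoff_nonneg (β := β) z.2
  have h3 := cutoff_nonneg (z.2 / T)
  have h4 := cutoff_le_one (z.2 / T)
  have hP0 : 0 ≤ P := (abs_nonneg _).trans (hP 0)
  have h5 : |deriv cutoff (‖z.1‖ ^ 2 / R ^ 2)| * ‖z.1‖ ≤ P * (2 * R) := by
    rcases le_total (2 * R) ‖z.1‖ with h | h
    · rw [deriv_cutoff_eq_zero_of_ge, abs_zero, zero_mul]
      · positivity
      · rw [le_div_iff₀ (by positivity)]
        nlinarith
    · exact mul_le_mul (hP _) h (norm_nonneg _) hP0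
  rw [testCutoffGrad, norm_smul, Real.norm_eq_abs, abs_mul, abs_mul, abs_mul, abs_mul, abs_mul,
    abs_of_nonneg (pow_nonneg h1 _), abs_of_nonneg h2, abs_of_nonneg h3,
    abs_of_nonneg (by positivity : (0 : ℝ) ≤ j + 2),
    abs_of_nonneg (by positivity : 0 ≤ 2 / R ^ 2)]
  calc _ = (j + 2 : ℝ) * cylCutoff R T z ^ (j + 1) * startCutoff β z.2 * (2 / R ^ 2) *
        (cutoff (z.2 / T) * (|deriv cutoff (‖z.1‖ ^ 2 / R ^ 2)| * ‖z.1‖)) := by ring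
    _ ≤ (j + 2 : ℝ) * cylCutoff R T z ^ (j + 1) * startCutoff β z.2 * (2 / R ^ 2) *
        (1 * (P * (2 * R))) := by gcongr
    _ = _ := by
        field_simp
        ring

lemma neg_testCutoffTime_le {P : ℝ} (hP : ∀ s, |deriv cutoff s| ≤ P) (hT : 0 < T) (hβ : 0 < β) :
    -testCutoffTime j R T β z ≤
      4 * (j + 2) * P / T * (cylCutoff R T z ^ (j + 1) * startCutoff β z.2) := by
  have h1 := cylCutoff_nonneg (R := R) (T := T) z
  have h2 := startCutoff_nonneg (β := β) z.2
  have h3 := cutoff_nonneg (‖z.1‖ ^ 2 / R ^ 2)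
  have h4 := cutoff_le_one (‖z.1‖ ^ 2 / R ^ 2)
  have hP0 : 0 ≤ P := (abs_nonneg _).trans (hP 0)
  have h5 : -deriv cutoff (z.2 / T) ≤ P := (neg_le_abs _).trans (hP _)
  have h6 := deriv_smoothTransition_nonneg (z.2 / β - 1)
  have h7 : 0 ≤ cylCutoff R T z ^ (j + 2) * (deriv smoothTransition (z.2 / β - 1) / β) := by
    positivity
  have h8 : cutoff (‖z.1‖ ^ 2 / R ^ 2) * (-deriv cutoff (z.2 / T)) ≤ 1 * (4 * P) := by
    nlinarith
  calc -testCutoffTime j R T β z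
      ≤ ((j + 2 : ℝ) * cylCutoff R T z ^ (j + 1) * startCutoff β z.2 / T) *
        (cutoff (‖z.1‖ ^ 2 / R ^ 2) * (-deriv cutoff (z.2 / T))) := by
        rw [testCutoffTime, neg_add]
        refine le_trans (add_le_of_nonpos_right (neg_nonpos.2 h7)) (le_of_eq ?_)
        ring
    _ ≤ ((j + 2 : ℝ) * cylCutoff R T z ^ (j + 1) * startCutoff β z.2 / T) * (1 * (4 * P)) := by
        gcongr
    _ = _ := by ring

end CutoffBounds

lemma hasFDerivAt_testCutoff {N : ℕ} (j : ℕ) (R T β : ℝ) (z : Euc N × ℝ) :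
    HasFDerivAt (testCutoff j R T β)
      (pairCLM (testCutoffGrad j R T β z) (testCutoffTime j R T β z)) z := by
  have hc : ∀ s, HasDerivAt cutoff (deriv cutoff s) s := fun s =>
    (contDiff_cutoff.differentiable (by simp) s).hasDerivAt
  have hst : ∀ s, HasDerivAt smoothTransition (deriv smoothTransition s) s := fun s =>
    ((smoothTransition.contDiff (n := 1)).differentiable (by simp) s).hasDerivAt
  have h1 : HasFDerivAt (fun z : Euc N × ℝ => ‖z.1‖ ^ 2 / R ^ 2)
      (pairCLM ((2 / R ^ 2) • z.1) 0) z := by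
    have := ((hasFDerivAt_fst (𝕜 := ℝ) (p := z)).norm_sq).mul_const ((R ^ 2)⁻¹)
    refine this.congr_fderiv (ContinuousLinearMap.ext fun w => ?_)
    simp [pairCLM_apply, real_inner_smul_left]
    ring
  have h2 : ∀ c : ℝ, HasFDerivAt (fun z : Euc N × ℝ => z.2 / c) (pairCLM 0 c⁻¹) z := by
    intro c
    have := (hasFDerivAt_snd (𝕜 := ℝ) (p := z)).mul_const c⁻¹
    refine this.congr_fderiv (ContinuousLinearMap.ext fun w => ?_)
    simp [pairCLM_apply]
  have h3 := (((hc _).comp_hasFDerivAt z h1).mul ((hc _).comp_hasFDerivAt z (h2 T))).pow (j + 2)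
  have h4 := (hst _).comp_hasFDerivAt z ((h2 β).sub_const 1)
  refine (h3.mul h4).congr_fderiv (ContinuousLinearMap.ext fun w => ?_)
  simp [pairCLM_apply, real_inner_smul_left, testCutoffGrad, testCutoffTime, cylCutoff,
    startCutoff]
  ring

lemma contDiff_testCutoff {N : ℕ} (j : ℕ) (R T β : ℝ) :
    ContDiff ℝ 1 (testCutoff (N := N) j R T β) := by
  have h1 : ContDiff ℝ 1 fun z : Euc N × ℝ => ‖z.1‖ ^ 2 / R ^ 2 :=
    (contDiff_fst.norm_sq ℝ).div_const _
  have h2 : ∀ c : ℝ, ContDiff ℝ 1 fun z : Euc N × ℝ => z.2 / c := fun c =>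
    contDiff_snd.div_const c
  exact (((contDiff_cutoff.comp h1).mul (contDiff_cutoff.comp (h2 T))).pow (j + 2)).mul
    ((smoothTransition.contDiff (n := 1)).comp ((h2 β).sub contDiff_const))

lemma tsupport_testCutoff_subset {N : ℕ} (j : ℕ) {R T β : ℝ} (hR : 0 < R) (hT : 0 < T)
    (hβ : 0 < β) :
    tsupport (testCutoff (N := N) j R T β) ⊆ closedBall 0 (2 * R) ×ˢ Icc β (2 * T) := by
  refine closure_minimal (fun z hz => ?_) (isClosed_closedBall.prod isClosed_Icc)
  rw [Function.mem_support, testCutoff] at hz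
  have h1 : cylCutoff R T z ≠ 0 := fun h => hz (by rw [h]; simp)
  have h2 : startCutoff β z.2 ≠ 0 := right_ne_zero_of_mul hz
  have h3 : ‖z.1‖ ≤ 2 * R ∧ z.2 ≤ 2 * T := by
    by_contra h
    exact h1 (cylCutoff_eq_zero hR hT h)
  refine ⟨by simpa using h3.1, ?_, h3.2⟩
  by_contra! h
  refine h2 (smoothTransition.zero_of_nonpos ?_)
  rw [sub_nonpos, div_le_one hβ]
  exact h.le

lemma hasCompactSupport_testCutoff {N : ℕ} (j : ℕ) {R T β : ℝ} (hR : 0 < R) (hT : 0 < T)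
    (hβ : 0 < β) : HasCompactSupport (testCutoff (N := N) j R T β) :=
  ((isCompact_closedBall _ _).prod isCompact_Icc).of_isClosed_subset (isClosed_tsupport _)
    (tsupport_testCutoff_subset j hR hT hβ)

lemma tsupport_testCutoff_subset_Sset {N : ℕ} (j : ℕ) {R T β : ℝ} (hR : 0 < R) (hT : 0 < T)
    (hβ : 0 < β) : tsupport (testCutoff (N := N) j R T β) ⊆ Sset N := fun _ hz =>
  hβ.trans_le (tsupport_testCutoff_subset j hR hT hβ hz).2.1

/-- The part of the slab between the cylinders of sizes `(R, T)` and `(2R, 2T)`. -/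
def outerRegion (N : ℕ) (R T : ℝ) : Set (Euc N × ℝ) :=
  (Sset N ∩ closedBall 0 (2 * R) ×ˢ Iic (2 * T)) \ (closedBall 0 R ×ˢ Iic T)

lemma measurableSet_outerRegion (N : ℕ) (R T : ℝ) : MeasurableSet (outerRegion N R T) :=
  ((isOpen_Sset N).measurableSet.inter (measurableSet_closedBall.prod measurableSet_Iic)).diff
    (measurableSet_closedBall.prod measurableSet_Iic)

lemma integrable_testCutoff_mul_rpow {N : ℕ} {a : Euc N → ℝ} [IsFiniteMeasureOnCompacts (muS a)]
    {u : Euc N × ℝ → ℝ} {q : ℝ} (hq : 0 < q) (hu : ContinuousOn u (Sset N)) (j : ℕ) {R T β : ℝ}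
    (hR : 0 < R) (hT : 0 < T) (hβ : 0 < β) :
    Integrable (fun z => testCutoff j R T β z * u z ^ q) (muS a) :=
  (continuous_mul_of_tsupport_subset (isOpen_Sset N) (contDiff_testCutoff j R T β).continuous
    (tsupport_testCutoff_subset_Sset j hR hT hβ)
    (hu.rpow_const fun _ _ => Or.inr hq.le)).integrable_of_hasCompactSupport
      (hasCompactSupport_testCutoff j hR hT hβ).mul_right

/-- The scale-invariant a priori estimate. -/
lemma IsWeakSol.exists_integral_testCutoff_le {N : ℕ} {m q d κ : ℝ} {j : ℕ} (hm : 1 ≤ m)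
    (hd : 0 < d) (hd1 : d < 1) (hq : m + d < q) (hκ : κ * (q - m) = 2) (hNκ : N ≤ κ)
    (hj : (j + 2) * (m + d) / q ≤ j) {a : Euc N → ℝ}
    (haLip : LocallyLipschitz a) (haPos : ∀ᵐ x, 0 < a x) {Ca : ℝ} (haB : ∀ x, |a x| ≤ Ca)
    {u : Euc N × ℝ → ℝ} {gu : Euc N × ℝ → Euc N} {ut : Euc N × ℝ → ℝ}
    (hu : IsWeakSol N 2 m q (fun _ => 1) (fun _ => m) a u gu ut) :
    ∃ C, 0 ≤ C ∧ ∀ μ η K, 0 < μ → 0 ≤ η → 0 ≤ K →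
      (∀ w, 0 ≤ w → youngFun m d μ w ≤ η + K * w ^ q) → ∀ R β, 1 ≤ R → 0 < β →
      ∫ z, testCutoff j R (R ^ (κ * (q - 1))) β z * u z ^ q ∂(muS a) ≤
        C * (η + K * ∫ z in outerRegion N R (R ^ (κ * (q - 1))),
          testCutoff j R (R ^ (κ * (q - 1))) β z * u z ^ q ∂(muS a)) := by
  have ham : Measurable a := haLip.continuous.measurable
  have := isFiniteMeasureOnCompacts_muS ham haB
  have hq0 : 0 < q := by linarith
  have hCa : 0 ≤ Ca := (abs_nonneg _).trans (haB 0)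
  obtain ⟨P0, hP0, hPb⟩ := exists_abs_deriv_cutoff_le
  set P : ℝ := 4 * (j + 2) * P0 with hPdef
  have hP : 0 ≤ P := by positivity
  set C1 : ℝ := m * P ^ 2 / d + 2 * P with hC1
  have hC1a : m * P ^ 2 / d ≤ C1 := by linarith
  have hC10 : 0 ≤ m * P ^ 2 / d := by positivity
  have hC1b : 2 * P ≤ C1 := by linarith
  have hC1n : 0 ≤ C1 := by linarith
  set V : ℝ := (volume (ball (0 : Euc N) 1)).toReal with hV
  have hV0 : 0 ≤ V := ENNReal.toReal_nonneg
  set C2 : ℝ := Ca * (2 ^ N * V * 2) with hC2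
  have hC20 : 0 ≤ C2 := by positivity
  refine ⟨2 * C1 * (C2 + 1), by positivity, fun μ η K hμ hη hK hF R β hR1 hβ => ?_⟩
  have hR : 0 < R := by linarith
  set T : ℝ := R ^ (κ * (q - 1)) with hTdef
  have hT : 0 < T := by positivity
  set φ : Euc N × ℝ → ℝ := testCutoff j R T β with hφ
  set D := outerRegion N R T with hD
  have hDm : MeasurableSet D := measurableSet_outerRegion N R T
  have hε : 0 < μ * R ^ (-κ) := by positivity
  have hRq : 0 < R ^ (-(κ * q)) := by positivity
  have hInt : Integrable (fun z => φ z * u z ^ q) (muS a) :=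
    integrable_testCutoff_mul_rpow hq0 hu.locLip.continuousOn j hR hT hβ
  have hDmeas : muS a D ≤ ENNReal.ofReal (Ca * ((2 * R) ^ N * V * (2 * T))) :=
    (measure_mono fun z hz => hz.1.2).trans (muS_cylinder_le ham haB (by positivity))
  have hDfin : muS a D < ⊤ := hDmeas.trans_lt ENNReal.ofReal_lt_top
  have hDreal : (muS a).real D * R ^ (-(κ * q)) ≤ C2 := by
    have h1 : (muS a).real D ≤ Ca * ((2 * R) ^ N * V * (2 * T)) :=
      ENNReal.toReal_le_of_le_ofReal (by positivity) hDmeas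
    have h2 : R ^ N ≤ R ^ κ := by
      rw [← Real.rpow_natCast]
      exact Real.rpow_le_rpow_of_exponent_le hR1 hNκ
    have h3 : R ^ κ * T * R ^ (-(κ * q)) = 1 := by
      rw [hTdef, ← Real.rpow_add hR, ← Real.rpow_add hR]
      ring_nf
      simp
    calc (muS a).real D * R ^ (-(κ * q))
        ≤ Ca * ((2 * R) ^ N * V * (2 * T)) * R ^ (-(κ * q)) := by gcongr
      _ = C2 * (R ^ N * T * R ^ (-(κ * q))) := by
          rw [hC2, mul_pow]
          ring
      _ ≤ C2 * (R ^ κ * T * R ^ (-(κ * q))) := by gcongr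
      _ = C2 := by rw [h3, mul_one]
  set b : Euc N × ℝ → ℝ := fun z => C1 * (R ^ (-(κ * q)) * η + K * (φ z * u z ^ q)) with hb
  have hconst : IntegrableOn (fun _ => R ^ (-(κ * q)) * η) D (muS a) :=
    integrableOn_const hDfin.ne
  have hbint : IntegrableOn b D (muS a) :=
    (hconst.add (hInt.integrableOn.const_mul K)).const_mul C1
  have hb0 : ∀ z ∈ Sset N, 0 ≤ b z := fun z hz => by
    have h1 := testCutoff_nonneg (R := R) (T := T) (β := β) j z
    have h2 := Real.rpow_nonneg (hu.nonneg z hz) q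
    positivity
  have hB0 : ∀ z, 0 ≤ D.indicator b z := fun z => indicator_nonneg (fun z hz => hb0 z hz.1.1) z
  have hcase : ∀ z ∈ Sset N, z ∉ D →
      (‖z.1‖ ≤ R ∧ z.2 ≤ T) ∨ ¬(‖z.1‖ ≤ 2 * R ∧ z.2 ≤ 2 * T) := by
    intro z hz hzD
    by_contra! h
    refine hzD ⟨⟨hz, by simpa using h.2.1, h.2.2⟩, fun h' => ?_⟩
    have := h.1 (by simpa using h'.1)
    exact absurd h'.2 (not_le.2 this)
  have hE := hu.integral_mul_rpow_le hq0 haLip haPos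
    (h := testNonlin d (μ * R ^ (-κ))) (h' := testNonlinDeriv d (μ * R ^ (-κ)))
    (H := testNonlinPrim d (μ * R ^ (-κ)))
    (fun s hs => hasDerivAt_testNonlin hε hs) (fun s hs => hasDerivAt_testNonlinPrim hε hd1 hs)
    (fun s hs => contDiffAt_testNonlin hε hs) (fun s hs => contDiffAt_testNonlinPrim hε hs)
    (fun s hs => one_le_testNonlin hε hs)
    (contDiff_testCutoff j R T β) (testCutoff_nonneg j) (hasCompactSupport_testCutoff j hR hT hβ)
    (tsupport_testCutoff_subset_Sset j hR hT hβ) (hasFDerivAt_testCutoff j R T β)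
    (B := D.indicator b) (hbint.integrable_indicator hDm) hB0 ?_ ?_
  · rw [integral_indicator hDm] at hE
    refine hE.trans ?_
    have e : ∫ z in D, b z ∂(muS a) = C1 * ((muS a).real D * R ^ (-(κ * q)) * η +
        K * ∫ z in D, φ z * u z ^ q ∂(muS a)) := by
      rw [hb, integral_const_mul, integral_add hconst
        (hInt.integrableOn.const_mul K), setIntegral_const, integral_const_mul, smul_eq_mul]
      ring
    have hI : 0 ≤ ∫ z in D, φ z * u z ^ q ∂(muS a) :=
      setIntegral_nonneg hDm fun z hz => mul_nonneg (testCutoff_nonneg j z)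
        (Real.rpow_nonneg (hu.nonneg z hz.1.1) q)
    have hKI := mul_nonneg hK hI
    rw [e]
    have h1 : (muS a).real D * R ^ (-(κ * q)) * η ≤ C2 * η := by gcongr
    have h2 : C2 * η + K * ∫ z in D, φ z * u z ^ q ∂(muS a) ≤
        (C2 + 1) * (η + K * ∫ z in D, φ z * u z ^ q ∂(muS a)) := by
      nlinarith [mul_nonneg hC20 hKI]
    calc _ ≤ 2 * (C1 * ((C2 + 1) * (η + K * ∫ z in D, φ z * u z ^ q ∂(muS a)))) := by
          gcongr
          linarith
      _ = _ := by ring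
  · intro z hz y
    have hU := hu.nonneg z hz
    have hUm : 0 ≤ m * u z ^ (m - 1) := by positivity
    by_cases hzD : z ∈ D
    · rw [indicator_of_mem hzD]
      refine (diffusion_term_le (P := P) hm hd hq hμ hη hF hκ hR hU (cylCutoff_nonneg z)
        (cylCutoff_le_one z) (startCutoff_nonneg z.2) (startCutoff_le_one z.2) hj
        (norm_testCutoffGrad_le j hPb hR)).trans ?_
      have h2 : 0 ≤ R ^ (-(κ * q)) * η + K * (φ z * u z ^ q) := by
        have := testCutoff_nonneg (R := R) (T := T) (β := β) j z
        positivity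
      exact mul_le_mul_of_nonneg_right hC1a h2
    · rw [indicator_of_notMem hzD]
      rcases hcase z hz hzD with h | h
      · rw [testCutoffGrad_eq_zero j hR h.1, inner_zero_left, mul_zero, zero_add]
        refine mul_nonpos_of_nonneg_of_nonpos hUm ?_
        have h1 := testCutoff_nonneg (R := R) (T := T) (β := β) j z
        have h2 : 0 ≤ d / (μ * R ^ (-κ)) * (1 + u z / (μ * R ^ (-κ))) ^ (-d - 1) := by positivity
        rw [testNonlinDeriv, mul_neg, neg_mul, neg_nonpos]
        positivity
      · simp [testCutoffGrad, testCutoff, cylCutoff_eq_zero hR hT h]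
  · intro z hz
    have hU := hu.nonneg z hz
    by_cases hzD : z ∈ D
    · rw [indicator_of_mem hzD]
      refine (time_term_le (P := P) hm hd hd1 hq hμ hη hF hR hP hU (cylCutoff_nonneg z)
        (cylCutoff_le_one z) (startCutoff_nonneg z.2) (startCutoff_le_one z.2) hj
        (neg_testCutoffTime_le j hPb hT hβ)).trans ?_
      have h2 : 0 ≤ R ^ (-(κ * q)) * η + K * (φ z * u z ^ q) := by
        have := testCutoff_nonneg (R := R) (T := T) (β := β) j z
        positivity
      exact mul_le_mul_of_nonneg_right hC1b h2
    · rw [indicator_of_notMem hzD]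
      rcases hcase z hz hzD with h | h
      · rw [neg_nonpos]
        exact mul_nonneg (testCutoffTime_nonneg j hT hβ h.2) (testNonlinPrim_nonneg hε hd1 hU)
      · simp [testCutoffTime, cylCutoff_eq_zero hR hT h]

/-- Porous medium (I3), Euclidean case: nonexistence for
`∂ₜ u ≥ Δ(u^m) + u^q` (here `p = 2`, `f ≡ m`). -/
theorem porous_medium_nonexistence
    (N : ℕ) (hN : 1 ≤ N) (m q : ℝ) (hm : 1 ≤ m)
    (a : Euc N → ℝ)
    (haLip : LocallyLipschitz a)
    (haPos : ∀ᵐ x ∂ (volume : Measure (Euc N)), 0 < a x)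
    (haBdd : ∃ Ca : ℝ, ∀ x, |a x| ≤ Ca)
    (hq1 : m < q) (hq2 : q ≤ 2 / (N : ℝ) + m)
    (u : Euc N × ℝ → ℝ) (gu : Euc N × ℝ → Euc N) (ut : Euc N × ℝ → ℝ)
    (hu : IsWeakSol N 2 m q (fun _ => 1) (fun _ => m) a u gu ut) :
    ∀ᵐ z ∂ ((volume : Measure (Euc N × ℝ)).restrict (Sset N)), u z = 0 := by
  obtain ⟨Ca, haB⟩ := haBdd
  have ham : Measurable a := haLip.continuous.measurable
  have := isFiniteMeasureOnCompacts_muS ham haB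
  have hq0 : 0 < q := by linarith
  have hqm : 0 < q - m := by linarith
  obtain ⟨d, hd, hd1, hdq⟩ : ∃ d : ℝ, 0 < d ∧ d < 1 ∧ m + d < q := by
    refine ⟨min 1 (q - m) / 2, by positivity, ?_, ?_⟩
    · linarith [min_le_left 1 (q - m)]
    · linarith [min_le_right 1 (q - m)]
  obtain ⟨j, hj⟩ : ∃ j : ℕ, ((j : ℝ) + 2) * (m + d) / q ≤ j := by
    have h1 : 0 < q - (m + d) := by linarith
    obtain ⟨j, hj⟩ := exists_nat_ge (2 * (m + d) / (q - (m + d)))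
    refine ⟨j, ?_⟩
    rw [div_le_iff₀ h1] at hj
    rw [div_le_iff₀ hq0]
    linarith
  have hN0 : (0 : ℝ) < N := by exact_mod_cast hN
  set κ : ℝ := 2 / (q - m) with hκdef
  have hκ : κ * (q - m) = 2 := div_mul_cancel₀ _ hqm.ne'
  have hNκ : (N : ℝ) ≤ κ := by
    rw [hκdef, le_div_iff₀ hqm]
    have : q - m ≤ 2 / N := by linarith
    rw [le_div_iff₀ hN0] at this
    linarith
  have hθ : 0 < κ * (q - 1) := mul_pos (by positivity) (by linarith)
  obtain ⟨C, hC, hest⟩ := hu.exists_integral_testCutoff_le hm hd hd1 hdq hκ hNκ hj haLip haPos haB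
  set R : ℕ → ℝ := fun n => n + 1 with hRdef
  have hR1 : ∀ n, 1 ≤ R n := fun n => by simp [hRdef]
  have hR0 : ∀ n, 0 < R n := fun n => one_pos.trans_le (hR1 n)
  have hRt : Filter.Tendsto R Filter.atTop Filter.atTop :=
    Filter.tendsto_atTop_add_const_right _ _ tendsto_natCast_atTop_atTop
  set T : ℕ → ℝ := fun n => R n ^ (κ * (q - 1)) with hTdef
  have hT0 : ∀ n, 0 < T n := fun n => Real.rpow_pos_of_pos (hR0 n) _
  have hTt : Filter.Tendsto T Filter.atTop Filter.atTop := (tendsto_rpow_atTop hθ).comp hRt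
  set β : ℕ → ℝ := fun n => (R n)⁻¹ with hβdef
  have hβ0 : ∀ n, 0 < β n := fun n => inv_pos.2 (hR0 n)
  have hβt : Filter.Tendsto β Filter.atTop (nhds 0) := tendsto_inv_atTop_zero.comp hRt
  set F : ℕ → Euc N × ℝ → ℝ := fun n z => testCutoff j (R n) (T n) (β n) z * u z ^ q with hF
  have hFi : ∀ n, Integrable (F n) (muS a) := fun n =>
    integrable_testCutoff_mul_rpow hq0 hu.locLip.continuousOn j (hR0 n) (hT0 n) (hβ0 n)
  have haeS : ∀ᵐ z ∂(muS a), z ∈ Sset N := by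
    rw [ae_muS_iff ham haPos]
    exact ae_restrict_mem (isOpen_Sset N).measurableSet
  have huq : ∀ z ∈ Sset N, 0 ≤ u z ^ q := fun z hz => Real.rpow_nonneg (hu.nonneg z hz) q
  have hF0 : ∀ n, ∀ z ∈ Sset N, 0 ≤ F n z := fun n z hz =>
    mul_nonneg (testCutoff_nonneg j z) (huq z hz)
  have hFle : ∀ n, ∀ z ∈ Sset N, F n z ≤ u z ^ q := fun n z hz =>
    mul_le_of_le_one_left (huq z hz) (testCutoff_le_one j z)
  have hin : ∀ z ∈ Sset N, ∀ᶠ n in Filter.atTop,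
      ‖z.1‖ ≤ R n ∧ z.2 ≤ T n ∧ 2 * β n ≤ z.2 := by
    intro z hz
    have hz' : 0 < z.2 := hz
    have h3 : ∀ᶠ n in Filter.atTop, β n < z.2 / 2 := hβt.eventually_lt_const (by linarith)
    filter_upwards [hRt.eventually_ge_atTop ‖z.1‖, hTt.eventually_ge_atTop z.2, h3]
      with n h1 h2 h3
    exact ⟨h1, h2, by linarith⟩
  have hFt : ∀ᵐ z ∂(muS a), Filter.Tendsto (fun n => F n z) Filter.atTop (nhds (u z ^ q)) := by
    filter_upwards [haeS] with z hz
    refine tendsto_const_nhds.congr' ?_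
    filter_upwards [hin z hz] with n hn
    simp [hF, testCutoff_eq_one j (hR0 n) (hT0 n) (hβ0 n) hn.1 hn.2.1 hn.2.2]
  have hum : AEStronglyMeasurable (fun z => u z ^ q) (muS a) :=
    aestronglyMeasurable_of_tendsto_ae Filter.atTop (fun n => (hFi n).aestronglyMeasurable) hFt
  obtain ⟨M, hM⟩ : ∃ M, ∀ n, ∫ z, F n z ∂(muS a) ≤ M := by
    obtain ⟨A, hA, hAw⟩ := exists_youngFun_one_le (δ := 1 / (2 * C + 1)) hm hd hdq (by positivity)
    refine ⟨2 * (C * A), fun n => ?_⟩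
    have h1 := hest 1 A (1 / (2 * C + 1)) one_pos hA (by positivity) hAw (R n) (β n) (hR1 n) (hβ0 n)
    have h2 : ∫ z in outerRegion N (R n) (T n), F n z ∂(muS a) ≤ ∫ z, F n z ∂(muS a) :=
      setIntegral_le_integral (hFi n) (haeS.mono fun z hz => hF0 n z hz)
    have h3 : 0 ≤ ∫ z, F n z ∂(muS a) := integral_nonneg_of_ae (haeS.mono fun z hz => hF0 n z hz)
    have h4 : C * (1 / (2 * C + 1)) ≤ 1 / 2 := by
      rw [mul_one_div, div_le_div_iff₀ (by positivity) (by positivity)]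
      linarith
    have h5 : C * (A + 1 / (2 * C + 1) * ∫ z in outerRegion N (R n) (T n), F n z ∂(muS a)) ≤
        C * A + 1 / 2 * ∫ z, F n z ∂(muS a) := by
      calc _ ≤ C * (A + 1 / (2 * C + 1) * ∫ z, F n z ∂(muS a)) := by gcongr
        _ = C * A + C * (1 / (2 * C + 1)) * ∫ z, F n z ∂(muS a) := by ring
        _ ≤ _ := by gcongr
    have h6 : ∫ z, F n z ∂(muS a) ≤ C * A + 1 / 2 * ∫ z, F n z ∂(muS a) := h1.trans h5
    linarith
  have hui : Integrable (fun z => u z ^ q) (muS a) := by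
    refine ⟨hum, ?_⟩
    rw [hasFiniteIntegral_iff_ofReal (haeS.mono fun z hz => huq z hz)]
    calc ∫⁻ z, ENNReal.ofReal (u z ^ q) ∂(muS a)
        = ∫⁻ z, Filter.liminf (fun n => ENNReal.ofReal (F n z)) Filter.atTop ∂(muS a) := by
          refine lintegral_congr_ae ?_
          filter_upwards [hFt] with z hz
          exact (ENNReal.tendsto_ofReal hz).liminf_eq.symm
      _ ≤ Filter.liminf (fun n => ∫⁻ z, ENNReal.ofReal (F n z) ∂(muS a)) Filter.atTop :=
          lintegral_liminf_le' fun n => (hFi n).aemeasurable.ennreal_ofReal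
      _ ≤ ENNReal.ofReal M := by
          refine Filter.liminf_le_of_frequently_le' (Filter.Frequently.of_forall fun n => ?_)
          rw [← ofReal_integral_eq_lintegral_ofReal (hFi n)
            (haeS.mono fun z hz => hF0 n z hz)]
          exact ENNReal.ofReal_le_ofReal (hM n)
      _ < ⊤ := ENNReal.ofReal_lt_top
  have hnorm : ∀ n, ∀ z ∈ Sset N, ‖F n z‖ ≤ u z ^ q := fun n z hz => by
    rw [Real.norm_of_nonneg (hF0 n z hz)]
    exact hFle n z hz
  have hlim1 : Filter.Tendsto (fun n => ∫ z, F n z ∂(muS a)) Filter.atTop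
      (nhds (∫ z, u z ^ q ∂(muS a))) :=
    tendsto_integral_of_dominated_convergence _ (fun n => (hFi n).aestronglyMeasurable) hui
      (fun n => haeS.mono fun z hz => hnorm n z hz) hFt
  have hlim2 : Filter.Tendsto (fun n => ∫ z in outerRegion N (R n) (T n), F n z ∂(muS a))
      Filter.atTop (nhds 0) := by
    have h := tendsto_integral_of_dominated_convergence (μ := muS a)
      (F := fun n => (outerRegion N (R n) (T n)).indicator (F n)) (f := fun _ => 0)
      (fun z => u z ^ q)
      (fun n => (hFi n).aestronglyMeasurable.indicator (measurableSet_outerRegion _ _ _)) hui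
      (fun n => haeS.mono fun z hz => (norm_indicator_le_norm_self _ _).trans (hnorm n z hz))
      (haeS.mono fun z hz => tendsto_const_nhds.congr' ((hin z hz).mono fun n hn =>
        (indicator_of_notMem (fun h => h.2 ⟨by simpa using hn.1, hn.2.1⟩) _).symm))
    simpa only [integral_indicator (measurableSet_outerRegion _ _ _), integral_zero] using h
  have hsmall : ∫ z, u z ^ q ∂(muS a) ≤ 0 := by
    refine le_of_forall_pos_le_add fun δ hδ => ?_
    obtain ⟨μ, K, hμ, hK, hw⟩ := exists_youngFun_le (η := δ / (C + 1)) hm hd hdq (by positivity)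
    have h1 := le_of_tendsto_of_tendsto' hlim1
      (((hlim2.const_mul K).const_add (δ / (C + 1))).const_mul C)
      fun n => hest μ (δ / (C + 1)) K hμ (by positivity) hK hw (R n) (β n) (hR1 n) (hβ0 n)
    have h2 : C * (δ / (C + 1)) ≤ δ := by
      rw [mul_div_assoc', div_le_iff₀ (by positivity)]
      linarith
    linarith
  have hzero := (integral_eq_zero_iff_of_nonneg_ae (haeS.mono fun z hz => huq z hz) hui).1
    (le_antisymm hsmall (integral_nonneg_of_ae (haeS.mono fun z hz => huq z hz)))
  rw [← ae_muS_iff ham haPos]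
  filter_upwards [hzero, haeS] with z hz hzS
  exact (Real.rpow_eq_zero (hu.nonneg z hzS) hq0.ne').1 hz

end
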